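/- Let D be a bounded domain in ℝⁿ (n>2) satisfying the uniform exterior sphere condition (each boundary point of D has an exterior osculating sphere of uniform size). Then the Poisson kernel P(x,y) = ∂G(x,y)/∂ν(y) satisfies 0 ≤ P(x,y) ≤ C·δ(x)/|x−y|ⁿ for all x ∈ D and y ∈ ∂D, where C depends only on D and n. -/

import Mathlib

noncomputable section

open MeasureTheory Metric Set Real
open scoped ENNReal NNReal RealInnerProductSpace FourierTransform

/-- Euclidean space ℝⁿ. -/
abbrev Eu (n : ℕ) := EuclideanSpace ℝ (Fin n)

variable {n : ℕ}

/-- δ(x) = dist(x, ℝⁿ ∖ D). -/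
def bdist (D : Set (Eu n)) (x : Eu n) : ℝ := Metric.infDist x Dᶜ

/-- First-order partial derivative ∂u/∂xᵢ. -/
def pd (i : Fin n) (u : Eu n → ℝ) (x : Eu n) : ℝ :=
  fderiv ℝ u x (EuclideanSpace.single i 1)

/-- Second-order partial derivative ∂²u/∂xᵢ∂xⱼ. -/
def pd2 (i j : Fin n) (u : Eu n → ℝ) : Eu n → ℝ :=
  fun x => pd i (fun z => pd j u z) x

/-- Iterated partial derivatives along a list of coordinate directions. -/
def pdMulti : List (Fin n) → (Eu n → ℝ) → Eu n → ℝ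
  | [], u => u
  | i :: L, u => pd i (pdMulti L u)

/-- The Laplacian Δu = Σᵢ ∂²u/∂xᵢ². -/
def lapl (u : Eu n → ℝ) (x : Eu n) : ℝ := ∑ i, pd2 i i u x

/-- A list of coordinate directions realizing the multi-index α. -/
def multiList (α : Fin n → ℕ) : List (Fin n) :=
  (List.finRange n).flatMap fun i => List.replicate (α i) i

/-- The derivative ∂^α u corresponding to a multi-index α. -/
def pdAlpha (α : Fin n → ℕ) (u : Eu n → ℝ) : Eu n → ℝ := pdMulti (multiList α) u

/-- The monomial y^α. -/
def monom (α : Fin n → ℕ) (y : Eu n) : ℝ := ∏ i, y i ^ α i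

/-- α! = ∏ᵢ (αᵢ)!. -/
def multiFact (α : Fin n → ℕ) : ℕ := ∏ i, Nat.factorial (α i)

/-- |α| = Σᵢ αᵢ. -/
def multiDeg (α : Fin n → ℕ) : ℕ := ∑ i, α i

/-- The finite set of multi-indices of degree at most k. -/
def multiIdxLE (n k : ℕ) : Finset (Fin n → ℕ) :=
  (Fintype.piFinset fun _ : Fin n => Finset.range (k + 1)).filter fun α => multiDeg α ≤ k

/-- A bounded domain: open, connected, bounded. -/
def IsBddDomain (D : Set (Eu n)) : Prop :=
  IsOpen D ∧ IsConnected D ∧ Bornology.IsBounded D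

/-- `v` is an outward unit normal vector to `D` at the boundary point `y`. -/
def IsOutwardNormalAt (D : Set (Eu n)) (y v : Eu n) : Prop :=
  ‖v‖ = 1 ∧ ∃ ε > 0, (∀ t : ℝ, 0 < t → t < ε → y + t • v ∉ closure D) ∧
    ∀ t : ℝ, 0 < t → t < ε → y - t • v ∈ D

/-- Hölder class C^s regularity of a globally defined function: it is C^⌊s⌋ and,
if s is not an integer, its ⌊s⌋-th derivative is Hölder continuous of exponent s - ⌊s⌋. -/
def HolderSmooth (s : ℝ) (g : Eu n → ℝ) : Prop :=
  ContDiff ℝ (⌊s⌋₊ : ℕ) g ∧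
    (s ≠ (⌊s⌋₊ : ℕ) → ∃ C : ℝ≥0,
      HolderWith C (s - (⌊s⌋₊ : ℕ)).toNNReal (iteratedFDeriv ℝ ⌊s⌋₊ g))

/-- C^{k,ε} regularity: C^k with ε-Hölder k-th derivatives. -/
def CkHolder (k : ℕ) (ε : ℝ) (g : Eu n → ℝ) : Prop :=
  ContDiff ℝ (k : ℕ) g ∧ ∃ C : ℝ≥0, HolderWith C ε.toNNReal (iteratedFDeriv ℝ k g)

/-- `D` has boundary which is locally the graph of a function enjoying the regularity
property `R`: near each boundary point, after choosing a unit direction `v`, the domain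
is the subgraph `{x | ⟪x,v⟫ < g x}` of a function `g` depending only on the component
orthogonal to `v`. -/
def HasGraphBoundary (D : Set (Eu n)) (R : (Eu n → ℝ) → Prop) : Prop :=
  ∀ y ∈ frontier D, ∃ v : Eu n, ‖v‖ = 1 ∧ ∃ V : Set (Eu n), IsOpen V ∧ y ∈ V ∧
    ∃ g : Eu n → ℝ, R g ∧ (∀ x : Eu n, g x = g (x - ⟪x, v⟫ • v)) ∧
      D ∩ V = {x ∈ V | ⟪x, v⟫ < g x} ∧
      frontier D ∩ V = {x ∈ V | ⟪x, v⟫ = g x}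

/-- The surface area ωₙ of the unit sphere in ℝⁿ. -/
def sphereArea (n : ℕ) : ℝ := n * (volume (Metric.ball (0 : Eu n) 1)).toReal

/-- The fundamental solution Γ of the Laplacian on ℝⁿ, n > 2. -/
def fundSol (n : ℕ) (x : Eu n) : ℝ :=
  -(((n : ℝ) - 2)⁻¹ * (sphereArea n)⁻¹ * ‖x‖ ^ (2 - (n : ℝ)))

/-- `u` is harmonic on `D`. -/
def IsHarmonicOn (u : Eu n → ℝ) (D : Set (Eu n)) : Prop :=
  ContDiffOn ℝ 2 u D ∧ ∀ x ∈ D, lapl u x = 0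

/-- `U` is the harmonic correction for the Green's function of `D`: for each `y ∈ D`,
`U(·,y)` is harmonic in `D`, continuous on `D̄`, with boundary values `Γ(y−·)`. -/
def IsGreenCorrection (D : Set (Eu n)) (U : Eu n → Eu n → ℝ) : Prop :=
  ∀ y ∈ D, IsHarmonicOn (fun x => U x y) D ∧
    ContinuousOn (fun x => U x y) (closure D) ∧
    ∀ x ∈ frontier D, U x y = fundSol n (y - x)

/-- The Green's function G(x,y) = Γ(x−y) − U(x,y). -/
def greenFn (U : Eu n → Eu n → ℝ) : Eu n → Eu n → ℝ :=
  fun x y => fundSol n (x - y) - U x y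

/-- `V` is the correction for the Neumann kernel of `D`: for each `y ∈ D`, `V(·,y)` solves
`ΔV(·,y) = Vol(D)⁻¹` in `D` with normal derivative `∂Γ(y−·)/∂ν` on `∂D`. -/
def IsNeumannCorrection (D : Set (Eu n)) (V : Eu n → Eu n → ℝ) : Prop :=
  ∀ y ∈ D, (ContDiffOn ℝ 2 (fun x => V x y) D ∧
      ∀ x ∈ D, lapl (fun x' => V x' y) x = ((volume D).toReal)⁻¹) ∧
    ∀ z ∈ frontier D, ∀ v : Eu n, IsOutwardNormalAt D z v →
      fderiv ℝ (fun x => V x y) z v = fderiv ℝ (fun x => fundSol n (y - x)) z v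

/-- `u` solves the Dirichlet problem Δu = f in D, u = 0 on ∂D. -/
def IsDirichletSol (D : Set (Eu n)) (f u : Eu n → ℝ) : Prop :=
  ContDiffOn ℝ 2 u D ∧ (∀ x ∈ D, lapl u x = f x) ∧
    ContinuousOn u (closure D) ∧ ∀ x ∈ frontier D, u x = 0

/-- `u` solves the Neumann problem Δu = f in D, ∂u/∂ν = 0 on ∂D. -/
def IsNeumannSol (D : Set (Eu n)) (f u : Eu n → ℝ) : Prop :=
  ContDiffOn ℝ 2 u D ∧ (∀ x ∈ D, lapl u x = f x) ∧
    ∀ y ∈ frontier D, ∀ v : Eu n, IsOutwardNormalAt D y v → fderiv ℝ u y v = 0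

/-- A fixed nonnegative smooth bump function supported in the unit ball with integral one. -/
structure IsBump (n : ℕ) (φ : Eu n → ℝ) : Prop where
  smooth : ContDiff ℝ (⊤ : ℕ∞) φ
  supp : ∀ x : Eu n, 1 ≤ ‖x‖ → φ x = 0
  nonneg : ∀ x, 0 ≤ φ x
  integral_one : ∫ x, φ x = 1

/-- φ_t(x) = t⁻ⁿ φ(x/t). -/
def dil (φ : Eu n → ℝ) (t : ℝ) (x : Eu n) : ℝ := t⁻¹ ^ n * φ (t⁻¹ • x)

/-- The radial maximal function f⁺(x) = sup_{0<t<δ(x)} |∫_D φ_t(x−y) f(y) dy|. -/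
def radMax (D : Set (Eu n)) (φ f : Eu n → ℝ) (x : Eu n) : ℝ :=
  ⨆ t : {t : ℝ // 0 < t ∧ t < bdist D x}, |∫ y in D, dil φ (t : ℝ) (x - y) * f y|

/-- The h^p_r(D) (quasi-)norm: the L^p(D) norm of the radial maximal function. -/
def hrNorm (D : Set (Eu n)) (φ : Eu n → ℝ) (p : ℝ) (f : Eu n → ℝ) : ℝ≥0∞ :=
  eLpNorm (radMax D φ f) (ENNReal.ofReal p) (volume.restrict D)

/-- The local (Goldberg) maximal function sup_{0<t<1} |φ_t * g(x)|. -/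
def locMax (φ g : Eu n → ℝ) (x : Eu n) : ℝ :=
  ⨆ t : {t : ℝ // 0 < t ∧ t < 1}, |∫ y, dil φ (t : ℝ) (x - y) * g y|

/-- Membership in the local Hardy space h^p(ℝⁿ). -/
def MemHp (φ : Eu n → ℝ) (p : ℝ) (g : Eu n → ℝ) : Prop :=
  Measurable g ∧ eLpNorm (locMax φ g) (ENNReal.ofReal p) volume < ⊤

/-- `g` is an extension of `f` to ℝⁿ vanishing off `D̄`. -/
def IsHpzExtension (D : Set (Eu n)) (f g : Eu n → ℝ) : Prop :=
  (∀ x ∈ D, g x = f x) ∧ ∀ x ∉ closure D, g x = 0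

/-- Membership in h^p_z(D): f has an extension in h^p(ℝⁿ) vanishing off D̄. -/
def MemHpz (D : Set (Eu n)) (φ : Eu n → ℝ) (p : ℝ) (f : Eu n → ℝ) : Prop :=
  ∃ g, IsHpzExtension D f g ∧ MemHp φ p g

/-- The h^p_z(D) (quasi-)norm: infimum of h^p(ℝⁿ) norms over all admissible extensions. -/
def hzNorm (D : Set (Eu n)) (φ : Eu n → ℝ) (p : ℝ) (f : Eu n → ℝ) : ℝ≥0∞ :=
  ⨅ g ∈ {g | IsHpzExtension D f g},
    eLpNorm (locMax φ g) (ENNReal.ofReal p) volume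

/-- An axis-parallel cube in ℝⁿ, given by its center and half side length. -/
structure Cube (n : ℕ) where
  center : Eu n
  half : ℝ
  half_pos : 0 < half

/-- The cube concentric with Q whose side length is c times that of Q. -/
def Cube.scaled (Q : Cube n) (c : ℝ) : Set (Eu n) :=
  {x | ∀ i, |x i - Q.center i| ≤ c * Q.half}

/-- The cube Q as a subset of ℝⁿ. -/
def Cube.carrier (Q : Cube n) : Set (Eu n) := Q.scaled 1

/-- |Q|, the volume of Q. -/
def Cube.vol (Q : Cube n) : ℝ := (2 * Q.half) ^ n

/-- The side length of Q. -/
def Cube.side (Q : Cube n) : ℝ := 2 * Q.half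

/-- [n(1/p−1)]. -/
def npIndex (n : ℕ) (p : ℝ) : ℕ := ⌊(n : ℝ) * (1 / p - 1)⌋₊

/-- An h^p(ℝⁿ) atom (p-atom) supported in the cube Q. -/
def IsPAtom (n : ℕ) (p : ℝ) (Q : Cube n) (a : Eu n → ℝ) : Prop :=
  Measurable a ∧ (∃ M : ℝ, ∀ x, |a x| ≤ M) ∧ (∀ x ∉ Q.carrier, a x = 0) ∧
    (∫ x, a x ^ 2) ≤ Q.vol ^ (1 - 2 / p) ∧
    (Q.vol ≤ 1 → ∀ α : Fin n → ℕ, multiDeg α ≤ npIndex n p →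
      ∫ x, monom α x * a x = 0)

/-- `g` is the weak partial derivative ∂f/∂xᵢ on `D`. -/
def IsWeakPd (D : Set (Eu n)) (i : Fin n) (f g : Eu n → ℝ) : Prop :=
  ∀ ψ : Eu n → ℝ, ContDiff ℝ (⊤ : ℕ∞) ψ → HasCompactSupport ψ → tsupport ψ ⊆ D →
    ∫ x in D, f x * pd i ψ x = -∫ x in D, g x * ψ x

/-- `g` is an iterated weak derivative of `f` on `D` along the list of directions `L`. -/
def IsWeakDerivSeq (D : Set (Eu n)) : List (Fin n) → (Eu n → ℝ) → (Eu n → ℝ) → Prop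
  | [], f, g => ∀ x ∈ D, f x = g x
  | i :: L, f, g => ∃ h, IsWeakDerivSeq D L f h ∧ IsWeakPd D i h g

/-- Membership in the Hardy–Sobolev space h^{k,p}_z(D): all weak derivatives of order ≤ k
lie in h^p_z(D). -/
def MemHkz (D : Set (Eu n)) (φ : Eu n → ℝ) (p : ℝ) (k : ℕ) (f : Eu n → ℝ) : Prop :=
  ∀ L : List (Fin n), L.length ≤ k → ∃ g, IsWeakDerivSeq D L f g ∧ MemHpz D φ p g

/-- The h^{k,p}_z(D) (quasi-)norm. -/
def hkzNorm (D : Set (Eu n)) (φ : Eu n → ℝ) (p : ℝ) (k : ℕ) (f : Eu n → ℝ) : ℝ≥0∞ :=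
  ⨆ L : {L : List (Fin n) // L.length ≤ k},
    ⨅ g ∈ {g | IsWeakDerivSeq D (L : List (Fin n)) f g}, hzNorm D φ p g

/-- The h^{k,p}_r(D) (quasi-)norm. -/
def hkrNorm (D : Set (Eu n)) (φ : Eu n → ℝ) (p : ℝ) (k : ℕ) (f : Eu n → ℝ) : ℝ≥0∞ :=
  ⨆ L : {L : List (Fin n) // L.length ≤ k},
    ⨅ g ∈ {g | IsWeakDerivSeq D (L : List (Fin n)) f g}, hrNorm D φ p g

/-- `D` satisfies the uniform exterior sphere condition: each boundary point has an
exterior osculating sphere of uniform size. -/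
def UnifExtSphere {n : ℕ} (D : Set (Eu n)) : Prop :=
  ∃ r : ℝ, 0 < r ∧ ∀ y ∈ frontier D, ∃ c : Eu n, dist y c = r ∧ Metric.ball c r ∩ D = ∅

/-! ### The Laplacian -/

theorem hasFDerivAt_rpow_normSq (a x : Eu n) (h : x ≠ a) (p : ℝ) :
    HasFDerivAt (fun z : Eu n => (‖z - a‖ ^ 2) ^ p)
      ((p * (‖x - a‖ ^ 2) ^ (p - 1)) • (2 • innerSL ℝ (x - a))) x := by
  have h1 : HasFDerivAt (fun z : Eu n => ‖z - a‖ ^ 2) (2 • innerSL ℝ (x - a)) x := by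
    simpa using ((hasFDerivAt_id x).sub_const a).norm_sq
  exact h1.rpow_const (Or.inl (by have := norm_pos_iff.2 (sub_ne_zero.2 h); positivity))

theorem pd_rpow_normSq (a x : Eu n) (h : x ≠ a) (p : ℝ) (i : Fin n) :
    pd i (fun z : Eu n => (‖z - a‖ ^ 2) ^ p) x
      = 2 * p * (‖x - a‖ ^ 2) ^ (p - 1) * (x i - a i) := by
  rw [pd, (hasFDerivAt_rpow_normSq a x h p).fderiv]
  simp [EuclideanSpace.inner_single_right]
  ring

theorem pd2_rpow_normSq (a x : Eu n) (h : x ≠ a) (p : ℝ) (i : Fin n) :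
    pd2 i i (fun z : Eu n => (‖z - a‖ ^ 2) ^ p) x
      = 2 * p * (‖x - a‖ ^ 2) ^ (p - 1)
        + 4 * p * (p - 1) * (‖x - a‖ ^ 2) ^ (p - 1 - 1) * (x i - a i) ^ 2 := by
  have he : (fun z => pd i (fun z : Eu n => (‖z - a‖ ^ 2) ^ p) z) =ᶠ[nhds x]
      fun z => 2 * p * ((‖z - a‖ ^ 2) ^ (p - 1) * (z i - a i)) := by
    filter_upwards [isOpen_ne.mem_nhds h] with z hz
    rw [pd_rpow_normSq a z hz, mul_assoc]
  have hc : HasFDerivAt (fun z : Eu n => z i - a i)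
      (EuclideanSpace.proj i : Eu n →L[ℝ] ℝ) x :=
    (EuclideanSpace.proj i : Eu n →L[ℝ] ℝ).hasFDerivAt.sub_const (a i)
  have hd : HasFDerivAt (fun z : Eu n => 2 * p * ((‖z - a‖ ^ 2) ^ (p - 1) * (z i - a i))) _ x :=
    ((hasFDerivAt_rpow_normSq a x h (p - 1)).mul hc).const_mul (2 * p)
  rw [pd2, pd, he.fderiv_eq, hd.fderiv]
  simp [EuclideanSpace.inner_single_right]
  ring

theorem lapl_rpow_normSq (a x : Eu n) (h : x ≠ a) (p : ℝ) :
    lapl (fun z : Eu n => (‖z - a‖ ^ 2) ^ p) x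
      = 2 * p * (n + 2 * (p - 1)) * (‖x - a‖ ^ 2) ^ (p - 1) := by
  have hq : 0 < ‖x - a‖ ^ 2 := by
    have := norm_pos_iff.2 (sub_ne_zero.2 h); positivity
  have hs : ∑ i, (x i - a i) ^ 2 = ‖x - a‖ ^ 2 := by
    rw [EuclideanSpace.real_norm_sq_eq]; simp
  simp only [lapl, pd2_rpow_normSq a x h]
  rw [Finset.sum_add_distrib, ← Finset.mul_sum Finset.univ (fun i => (x i - a i) ^ 2), hs, mul_assoc (4 * p * (p - 1)),
    ← Real.rpow_add_one hq.ne']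
  simp
  ring

theorem pd_add_eventuallyEq {u v : Eu n → ℝ} {x : Eu n} (hu : ContDiffAt ℝ 2 u x)
    (hv : ContDiffAt ℝ 2 v x) (i : Fin n) :
    (fun z => pd i (fun w => u w + v w) z) =ᶠ[nhds x] fun z => pd i u z + pd i v z := by
  filter_upwards [hu.eventually (by simp), hv.eventually (by simp)] with z hz hz'
  rw [pd, fderiv_fun_add (hz.differentiableAt (by simp)) (hz'.differentiableAt (by simp))]
  rfl

theorem differentiableAt_pd {u : Eu n → ℝ} {x : Eu n} (hu : ContDiffAt ℝ 2 u x) (i : Fin n) :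
    DifferentiableAt ℝ (fun z => pd i u z) x := by
  have h : ContDiffAt ℝ 1 (fderiv ℝ u) x := hu.fderiv_right (by norm_num)
  exact (h.differentiableAt (by simp)).clm_apply (differentiableAt_const _)

theorem lapl_add {u v : Eu n → ℝ} {x : Eu n} (hu : ContDiffAt ℝ 2 u x)
    (hv : ContDiffAt ℝ 2 v x) : lapl (fun w => u w + v w) x = lapl u x + lapl v x := by
  simp only [lapl, ← Finset.sum_add_distrib]
  refine Finset.sum_congr rfl fun i _ => ?_
  rw [pd2, pd, (pd_add_eventuallyEq hu hv i).fderiv_eq,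
    fderiv_fun_add (differentiableAt_pd hu i) (differentiableAt_pd hv i)]
  rfl

theorem lapl_const_mul (c : ℝ) (u : Eu n → ℝ) (x : Eu n) :
    lapl (fun w => c * u w) x = c * lapl u x := by
  have h (i : Fin n) (f : Eu n → ℝ) : pd i (fun w => c * f w) = fun z => c * pd i f z := by
    funext z
    exact congrArg (fun L : Eu n →L[ℝ] ℝ => L (EuclideanSpace.single i 1))
      (congrFun (fderiv_const_smul_field c) z)
  simp only [lapl, pd2, h, Finset.mul_sum]

theorem lapl_const (c : ℝ) (x : Eu n) : lapl (fun _ : Eu n => c) x = 0 := by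
  simp [lapl, pd2, pd]

theorem lapl_normSq (a x : Eu n) : lapl (fun z : Eu n => ‖z - a‖ ^ 2) x = 2 * n := by
  have h (i : Fin n) : pd i (fun z : Eu n => ‖z - a‖ ^ 2) = fun z => 2 * (z i - a i) := by
    funext z
    have h1 : HasFDerivAt (fun z : Eu n => ‖z - a‖ ^ 2) (2 • innerSL ℝ (z - a)) z := by
      simpa using ((hasFDerivAt_id z).sub_const a).norm_sq
    rw [pd, h1.fderiv]
    simp [EuclideanSpace.inner_single_right]
  have hc (i : Fin n) : HasFDerivAt (fun z : Eu n => z i - a i)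
      (EuclideanSpace.proj i : Eu n →L[ℝ] ℝ) x :=
    (EuclideanSpace.proj i : Eu n →L[ℝ] ℝ).hasFDerivAt.sub_const (a i)
  have h2 (i : Fin n) : pd2 i i (fun z : Eu n => ‖z - a‖ ^ 2) x = 2 := by
    simp only [pd2, h]
    rw [pd, ((hc i).const_mul 2).fderiv]
    simp
  simp [lapl, h2, mul_comm]

/-! ### The weak maximum principle -/

theorem IsLocalMax.pd2_nonpos {u : Eu n → ℝ} {x : Eu n} (hu : ContDiffAt ℝ 2 u x)
    (h : IsLocalMax u x) (i : Fin n) : pd2 i i u x ≤ 0 := by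
  by_contra! hpos
  set e : Eu n := EuclideanSpace.single i 1
  have hl (t : ℝ) : HasDerivAt (fun t : ℝ => x + t • e) e t := by
    simpa using ((hasDerivAt_id t).smul_const e).const_add x
  have ht : Filter.Tendsto (fun t : ℝ => x + t • e) (nhds 0) (nhds x) := by
    simpa using (hl 0).continuousAt.tendsto
  have hd : deriv (fun t : ℝ => u (x + t • e)) =ᶠ[nhds 0] fun t => pd i u (x + t • e) := by
    filter_upwards [ht.eventually (hu.eventually (by simp))] with t hz
    exact ((hz.differentiableAt (by simp)).hasFDerivAt.comp_hasDerivAt t (hl t)).deriv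
  have hdd : deriv (deriv fun t : ℝ => u (x + t • e)) 0 = pd2 i i u x := by
    rw [hd.deriv_eq]
    have h0 : HasFDerivAt (fun z => pd i u z) (fderiv ℝ (fun z => pd i u z) x)
        (x + (0 : ℝ) • e) := by
      simpa using (differentiableAt_pd hu i).hasFDerivAt
    exact (h0.comp_hasDerivAt 0 (hl 0)).deriv
  have hmax : IsLocalMax (fun t : ℝ => u (x + t • e)) 0 := by
    have := ht.eventually h
    simpa [IsLocalMax, IsMaxFilter] using this
  have hmin : IsLocalMin (fun t : ℝ => u (x + t • e)) 0 :=
    isLocalMin_of_deriv_deriv_pos (by rwa [hdd]) hmax.deriv_eq_zero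
      (ContinuousAt.comp (by simpa using hu.continuousAt) (hl 0).continuousAt)
  have hc : (fun t : ℝ => u (x + t • e)) =ᶠ[nhds 0] fun _ => u (x + (0 : ℝ) • e) := by
    filter_upwards [hmax, hmin] with t h1 h2 using le_antisymm h1 h2
  have : deriv (deriv fun t : ℝ => u (x + t • e)) 0 = 0 := by
    rw [hc.deriv.deriv_eq]; simp
  linarith

theorem IsLocalMax.lapl_nonpos {u : Eu n → ℝ} {x : Eu n} (hu : ContDiffAt ℝ 2 u x)
    (h : IsLocalMax u x) : lapl u x ≤ 0 :=
  Finset.sum_nonpos fun i _ => h.pd2_nonpos hu i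

theorem contDiff_normSq_sub (a : Eu n) : ContDiff ℝ 2 fun z : Eu n => ‖z - a‖ ^ 2 :=
  (contDiff_id.sub contDiff_const).norm_sq ℝ

theorem IsHarmonicOn.nonpos_of_boundary {u : Eu n → ℝ} {W : Set (Eu n)} (hn : 0 < n)
    (hW : IsOpen W) (hb : Bornology.IsBounded W) (hu : IsHarmonicOn u W)
    (hc : ContinuousOn u (closure W)) (h : ∀ x ∈ closure W, x ∉ W → u x ≤ 0) :
    ∀ x ∈ W, u x ≤ 0 := by
  intro a ha
  by_contra! hpos
  obtain ⟨d, hd0, hd⟩ := hb.closure.subset_closedBall_lt 0 a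
  set ε := u a / (2 * d ^ 2)
  have hε : 0 < ε := by positivity
  have hcont : ContinuousOn (fun z => u z + ε * ‖z - a‖ ^ 2) (closure W) :=
    hc.add (by fun_prop)
  obtain ⟨p, hp, hmax⟩ := (Metric.isCompact_of_isClosed_isBounded isClosed_closure
    hb.closure).exists_isMaxOn ⟨a, subset_closure ha⟩ hcont
  have hpa : u a ≤ u p + ε * ‖p - a‖ ^ 2 := by simpa using hmax (subset_closure ha)
  have hpW : p ∈ W := by
    by_contra hpW
    have h1 := h p hp hpW
    have h2 : ‖p - a‖ ≤ d := by simpa [dist_eq_norm] using hd hp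
    have h3 : ε * ‖p - a‖ ^ 2 ≤ ε * d ^ 2 := by gcongr
    have h4 : ε * d ^ 2 = u a / 2 := by simp only [ε]; field_simp
    linarith
  have hup : ContDiffAt ℝ 2 u p := hu.1.contDiffAt (hW.mem_nhds hpW)
  have hq : ContDiffAt ℝ 2 (fun z : Eu n => ε * ‖z - a‖ ^ 2) p :=
    contDiffAt_const.mul (contDiff_normSq_sub a).contDiffAt
  have hloc : IsLocalMax (fun z => u z + ε * ‖z - a‖ ^ 2) p :=
    (hmax.on_subset subset_closure).isLocalMax (hW.mem_nhds hpW)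
  have := hloc.lapl_nonpos (hup.add hq)
  rw [lapl_add hup hq, hu.2 p hpW, lapl_const_mul, lapl_normSq] at this
  have : (0 : ℝ) < ε * (2 * n) := by positivity
  linarith

/-! ### Harmonic functions -/

theorem IsHarmonicOn.mono {u : Eu n → ℝ} {D W : Set (Eu n)} (hu : IsHarmonicOn u D)
    (h : W ⊆ D) : IsHarmonicOn u W :=
  ⟨hu.1.mono h, fun x hx => hu.2 x (h hx)⟩

theorem IsHarmonicOn.add {u v : Eu n → ℝ} {W : Set (Eu n)} (hW : IsOpen W)
    (hu : IsHarmonicOn u W) (hv : IsHarmonicOn v W) :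
    IsHarmonicOn (fun x => u x + v x) W :=
  ⟨hu.1.add hv.1, fun x hx => by
    rw [lapl_add (hu.1.contDiffAt (hW.mem_nhds hx)) (hv.1.contDiffAt (hW.mem_nhds hx)),
      hu.2 x hx, hv.2 x hx, add_zero]⟩

theorem IsHarmonicOn.const_mul {u : Eu n → ℝ} {W : Set (Eu n)} (hu : IsHarmonicOn u W)
    (c : ℝ) : IsHarmonicOn (fun x => c * u x) W :=
  ⟨contDiffOn_const.mul hu.1, fun x hx => by rw [lapl_const_mul, hu.2 x hx, mul_zero]⟩

theorem isHarmonicOn_const (c : ℝ) (W : Set (Eu n)) : IsHarmonicOn (fun _ => c) W :=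
  ⟨contDiffOn_const, fun x _ => lapl_const c x⟩

/-- The Newtonian potential `‖x - a‖ ^ (2 - n)` of a unit mass at `a`. -/
def newton (a x : Eu n) : ℝ := (‖x - a‖ ^ (n - 2))⁻¹

theorem newton_eq_rpow (hn : 2 < n) (a : Eu n) :
    newton a = fun x => (‖x - a‖ ^ 2) ^ ((2 - (n : ℝ)) / 2) := by
  funext x
  rw [← Real.rpow_natCast ‖x - a‖ 2, ← Real.rpow_mul (norm_nonneg _), newton,
    ← Real.rpow_natCast, ← Real.rpow_neg (norm_nonneg _), Nat.cast_sub hn.le]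
  congr 1
  push_cast
  ring

theorem isHarmonicOn_newton (hn : 2 < n) {a : Eu n} {W : Set (Eu n)} (h : a ∉ W) :
    IsHarmonicOn (newton a) W := by
  have hne : ∀ x ∈ W, x ≠ a := fun x hx hxa => h (hxa ▸ hx)
  constructor
  · rw [newton_eq_rpow hn]
    refine (contDiff_normSq_sub a).contDiffOn.rpow_const_of_ne fun x hx => ?_
    have := norm_pos_iff.2 (sub_ne_zero.2 (hne x hx))
    positivity
  · intro x hx
    rw [newton_eq_rpow hn, lapl_rpow_normSq a x (hne x hx)]
    ring

theorem continuousOn_newton {a : Eu n} {W : Set (Eu n)} (h : a ∉ W) :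
    ContinuousOn (newton a) W := by
  refine ContinuousOn.inv₀ (by fun_prop) fun x hx => ?_
  have := norm_pos_iff.2 (sub_ne_zero.2 (show x ≠ a from fun hxa => h (hxa ▸ hx)))
  positivity

/-! ### Elementary estimates -/

theorem one_sub_pow_le_mul_inv_sub_one {q : ℝ} (hq : 0 < q) (m : ℕ) :
    1 - q ^ m ≤ m * (q⁻¹ - 1) := by
  have h1 : 1 + (m : ℝ) * (q - 1) ≤ (1 + (q - 1)) ^ m := one_add_mul_le_pow (by linarith) m
  rw [add_sub_cancel] at h1
  have h2 : 2 ≤ q + q⁻¹ := by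
    have : q + q⁻¹ - 2 = (q - 1) ^ 2 * q⁻¹ := by field_simp; ring
    have : 0 ≤ (q - 1) ^ 2 * q⁻¹ := by positivity
    linarith
  have h3 : (m : ℝ) * (1 - q) ≤ m * (q⁻¹ - 1) :=
    mul_le_mul_of_nonneg_left (by linarith) m.cast_nonneg
  linarith

theorem inv_pow_sub_le {a b r s t d : ℝ} (ha : 0 < a) (hb : 0 < b) (hr : 0 < r) (hs : 0 < s)
    (hst : s ≤ r + t) (ht : 0 ≤ t) (htr : t ≤ r) (hbt : b ≤ a + 2 * t) (had : a ≤ d) (m : ℕ) :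
    (a ^ m)⁻¹ - (r / s) ^ m * (b ^ m)⁻¹ ≤ (d / r + 4) * m * t * (a ^ (m + 1))⁻¹ := by
  have hq : 0 < a * r / (s * b) := by positivity
  have h1 := one_sub_pow_le_mul_inv_sub_one hq m
  have h2 : (a * r / (s * b))⁻¹ - 1 ≤ t / a * (d / r + 4) := by
    have e1 : (a * r / (s * b))⁻¹ - 1 = (s * b - a * r) / (a * r) := by field_simp
    have e2 : t / a * (d / r + 4) = (t * d + 4 * t * r) / (a * r) := by field_simp
    rw [e1, e2]
    gcongr
    have : s * b ≤ (r + t) * (a + 2 * t) := by gcongr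
    nlinarith
  have h3 : (a ^ m)⁻¹ - (r / s) ^ m * (b ^ m)⁻¹ = (a ^ m)⁻¹ * (1 - (a * r / (s * b)) ^ m) := by
    rw [div_pow, div_pow, mul_pow, mul_pow]
    field_simp
  calc (a ^ m)⁻¹ - (r / s) ^ m * (b ^ m)⁻¹
      = (a ^ m)⁻¹ * (1 - (a * r / (s * b)) ^ m) := h3
    _ ≤ (a ^ m)⁻¹ * (m * (t / a * (d / r + 4))) := by gcongr; exact h1.trans (by gcongr)
    _ = (d / r + 4) * m * t * (a ^ (m + 1))⁻¹ := by
      rw [pow_succ]; field_simp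

/-! ### Exterior balls -/

theorem le_norm_sub_of_mem_closure {D : Set (Eu n)} {c ξ : Eu n} {r : ℝ}
    (h : Metric.ball c r ∩ D = ∅) (hξ : ξ ∈ closure D) : r ≤ ‖ξ - c‖ := by
  by_contra! hlt
  obtain ⟨p, hp, hpD⟩ := mem_closure_iff.1 hξ _ Metric.isOpen_ball
    (show ξ ∈ Metric.ball c r by rwa [mem_ball_iff_norm])
  exact (Set.eq_empty_iff_forall_notMem.1 h p) ⟨hp, hpD⟩

theorem lt_norm_sub_of_mem {D : Set (Eu n)} (hD : IsOpen D) {c ξ : Eu n} {r : ℝ} (hr : 0 < r)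
    (h : Metric.ball c r ∩ D = ∅) (hξ : ξ ∈ D) : r < ‖ξ - c‖ := by
  have hd : Disjoint (closure (Metric.ball c r)) D :=
    (Set.disjoint_iff_inter_eq_empty.2 h).closure_left hD
  rw [closure_ball c hr.ne'] at hd
  by_contra! hle
  exact Set.disjoint_left.1 hd (mem_closedBall_iff_norm.2 hle) hξ

theorem exists_smaller_exterior_ball {D : Set (Eu n)} {y c : Eu n} {r ρ : ℝ} (hr : 0 < r)
    (hyc : dist y c = r) (h : Metric.ball c r ∩ D = ∅) (hρ : 0 ≤ ρ) (hρr : ρ ≤ r) :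
    ∃ c', dist y c' = ρ ∧ Metric.ball c' ρ ∩ D = ∅ := by
  have hn : ‖c - y‖ = r := by rw [← dist_eq_norm, dist_comm, hyc]
  refine ⟨y + (ρ / r) • (c - y), ?_, ?_⟩
  · rw [dist_self_add_right, norm_smul, hn, Real.norm_of_nonneg (by positivity)]
    field_simp
  · refine Set.eq_empty_of_subset_empty fun p hp => ?_
    rw [← h]
    refine ⟨?_, hp.2⟩
    have h1 := mem_ball_iff_norm.1 hp.1
    have h2 : ‖y + (ρ / r) • (c - y) - c‖ = r - ρ := by
      have : y + (ρ / r) • (c - y) - c = (1 - ρ / r) • (y - c) := by module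
      rw [this, norm_smul, ← norm_neg (y - c), neg_sub, hn, Real.norm_of_nonneg]
      · field_simp
      · rw [sub_nonneg, div_le_one hr]; exact hρr
    have h3 := norm_sub_le_norm_sub_add_norm_sub p (y + (ρ / r) • (c - y)) c
    rw [mem_ball_iff_norm]
    linarith

/-- Inversion in the sphere of centre `c` and radius `r`. -/
def sphereInv (c : Eu n) (r : ℝ) (z : Eu n) : Eu n := c + (r ^ 2 / ‖z - c‖ ^ 2) • (z - c)

theorem norm_sphereInv_sub (c : Eu n) {r : ℝ} {z : Eu n} (hz : 0 < ‖z - c‖) :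
    ‖sphereInv c r z - c‖ = r ^ 2 / ‖z - c‖ := by
  rw [sphereInv, add_sub_cancel_left, norm_smul, Real.norm_of_nonneg (by positivity)]
  field_simp

theorem norm_sub_sphereInv (c : Eu n) {r : ℝ} {z : Eu n} (hr : 0 < r) (hz : r ≤ ‖z - c‖) :
    ‖z - sphereInv c r z‖ ≤ 2 * (‖z - c‖ - r) := by
  have hs : 0 < ‖z - c‖ := hr.trans_le hz
  have : z - sphereInv c r z = (1 - r ^ 2 / ‖z - c‖ ^ 2) • (z - c) := by
    rw [sphereInv]; module
  rw [this, norm_smul, Real.norm_of_nonneg]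
  · have : (1 - r ^ 2 / ‖z - c‖ ^ 2) * ‖z - c‖
        = (‖z - c‖ - r) * ((‖z - c‖ + r) / ‖z - c‖) := by field_simp; ring
    rw [this, mul_comm 2]
    gcongr
    rw [div_le_iff₀ hs]; linarith
  · rw [sub_nonneg, div_le_one (by positivity)]
    gcongr

theorem mul_norm_sub_le_mul_norm_sub_sphereInv {c ξ z : Eu n} {r : ℝ} (hr : 0 < r)
    (hz : r ≤ ‖z - c‖) (hξ : r ≤ ‖ξ - c‖) :
    r * ‖ξ - z‖ ≤ ‖z - c‖ * ‖ξ - sphereInv c r z‖ := by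
  have hs : 0 < ‖z - c‖ := hr.trans_le hz
  refine le_of_sq_le_sq ?_ (by positivity)
  have e1 : ξ - z = (ξ - c) - (z - c) := by abel
  have e2 : ξ - sphereInv c r z = (ξ - c) - (r ^ 2 / ‖z - c‖ ^ 2) • (z - c) := by
    rw [sphereInv]; abel
  rw [mul_pow, mul_pow, e1, e2, norm_sub_sq_real (ξ - c), norm_sub_sq_real (ξ - c), norm_smul,
    inner_smul_right, Real.norm_of_nonneg (by positivity)]
  have h1 : 0 ≤ (‖ξ - c‖ ^ 2 - r ^ 2) * (‖z - c‖ ^ 2 - r ^ 2) :=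
    mul_nonneg (sub_nonneg.2 (by gcongr)) (sub_nonneg.2 (by gcongr))
  have h2 : ‖z - c‖ ^ 2 * (‖ξ - c‖ ^ 2 - 2 * (r ^ 2 / ‖z - c‖ ^ 2 * inner ℝ (ξ - c) (z - c))
      + (r ^ 2 / ‖z - c‖ ^ 2 * ‖z - c‖) ^ 2)
      = ‖z - c‖ ^ 2 * ‖ξ - c‖ ^ 2 - 2 * r ^ 2 * inner ℝ (ξ - c) (z - c) + r ^ 4 := by
    field_simp
  rw [h2]
  linarith

/-- A barrier estimate: a harmonic function vanishing on the part of `∂D` near a point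
admitting an exterior ball grows at most linearly away from that point. -/
theorem IsHarmonicOn.le_of_exterior_ball (hn : 2 < n) {D : Set (Eu n)} (hD : IsOpen D)
    {u : Eu n → ℝ} {y c x : Eu n} {ρ R M : ℝ} (hρ : 0 < ρ) (hρR : 3 * ρ ≤ R) (hM : 0 ≤ M)
    (hyc : dist y c = ρ) (hball : Metric.ball c ρ ∩ D = ∅)
    (hu : IsHarmonicOn u (D ∩ Metric.ball y R))
    (hc : ContinuousOn u (closure (D ∩ Metric.ball y R)))
    (h0 : ∀ ξ ∈ closure D, ξ ∉ D → dist ξ y ≤ R → u ξ ≤ 0)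
    (hMb : ∀ ξ ∈ D, dist ξ y = R → u ξ ≤ M) (hx : x ∈ D) (hxy : dist x y < R) :
    u x ≤ 2 * M * (n - 2 : ℕ) * (dist x y / ρ) := by
  have hW : IsOpen (D ∩ Metric.ball y R) := hD.inter Metric.isOpen_ball
  have hcl : ∀ ξ ∈ closure (D ∩ Metric.ball y R), ρ ≤ ‖ξ - c‖ ∧ dist ξ y ≤ R := fun ξ hξ =>
    ⟨le_norm_sub_of_mem_closure hball (closure_mono Set.inter_subset_left hξ),
      Metric.closure_ball_subset_closedBall (closure_mono Set.inter_subset_right hξ)⟩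
  have hcW : c ∉ closure (D ∩ Metric.ball y R) := fun h => by
    have := (hcl c h).1
    simp at this
    linarith
  have hv : IsHarmonicOn (fun ξ => u ξ + (2 * M * ρ ^ (n - 2) * newton c ξ + -(2 * M)))
      (D ∩ Metric.ball y R) :=
    hu.add hW (((isHarmonicOn_newton hn fun h => hcW (subset_closure h)).const_mul _).add hW
      (isHarmonicOn_const _ _))
  have hvc : ContinuousOn (fun ξ => u ξ + (2 * M * ρ ^ (n - 2) * newton c ξ + -(2 * M)))
      (closure (D ∩ Metric.ball y R)) :=
    hc.add ((continuousOn_const.mul (continuousOn_newton hcW)).add continuousOn_const)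
  have hmul (ξ : Eu n) : ρ ^ (n - 2) * newton c ξ = (ρ / ‖ξ - c‖) ^ (n - 2) := by
    rw [newton, div_pow, div_eq_mul_inv]
  have key := hv.nonpos_of_boundary (by omega) hW
    (Metric.isBounded_ball.subset Set.inter_subset_right) hvc (fun ξ hξ hξW => by
      obtain ⟨h1, h2⟩ := hcl ξ hξ
      have hpos : 0 < ‖ξ - c‖ := hρ.trans_le h1
      rw [mul_assoc, hmul]
      by_cases hξD : ξ ∈ D
      · have hR : dist ξ y = R := le_antisymm h2 (not_lt.1 fun h => hξW ⟨hξD, h⟩)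
        have h3 : 2 * ρ ≤ ‖ξ - c‖ := by
          have := dist_triangle_right ξ y c
          rw [← dist_eq_norm]; linarith
        have h4 : (ρ / ‖ξ - c‖) ^ (n - 2) ≤ 1 / 2 := by
          have h5 : ρ / ‖ξ - c‖ ≤ 1 / 2 := by rw [div_le_div_iff₀ hpos two_pos]; linarith
          calc (ρ / ‖ξ - c‖) ^ (n - 2) ≤ (ρ / ‖ξ - c‖) ^ 1 :=
                pow_le_pow_of_le_one (by positivity) (by linarith) (by omega)
            _ ≤ 1 / 2 := by rwa [pow_one]
        have := hMb ξ hξD hR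
        have : 2 * M * (ρ / ‖ξ - c‖) ^ (n - 2) ≤ 2 * M * (1 / 2) := by gcongr
        linarith
      · have := h0 ξ (closure_mono Set.inter_subset_left hξ) hξD h2
        have h4 : (ρ / ‖ξ - c‖) ^ (n - 2) ≤ 1 :=
          pow_le_one₀ (by positivity) ((div_le_one hpos).2 h1)
        have : 2 * M * (ρ / ‖ξ - c‖) ^ (n - 2) ≤ 2 * M * 1 := by gcongr
        linarith) x ⟨hx, hxy⟩
  have hxc := (hcl x (subset_closure ⟨hx, hxy⟩)).1
  have hpos : 0 < ‖x - c‖ := hρ.trans_le hxc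
  rw [mul_assoc, hmul] at key
  have h1 := one_sub_pow_le_mul_inv_sub_one (q := ρ / ‖x - c‖) (by positivity) (n - 2)
  have h2 : (ρ / ‖x - c‖)⁻¹ - 1 ≤ dist x y / ρ := by
    have := dist_triangle x y c
    rw [inv_div, div_sub_one hρ.ne', ← dist_eq_norm]
    gcongr
    linarith
  calc u x ≤ 2 * M * (1 - (ρ / ‖x - c‖) ^ (n - 2)) := by linarith
    _ ≤ 2 * M * ((n - 2 : ℕ) * (dist x y / ρ)) := by gcongr; exact h1.trans (by gcongr)
    _ = _ := by ring

/-! ### Bounds for the Green's function -/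

/-- The constant `((n - 2) ωₙ)⁻¹` of the fundamental solution. -/
def fundConst (n : ℕ) : ℝ := ((n : ℝ) - 2)⁻¹ * (sphereArea n)⁻¹

theorem fundConst_pos (hn : 2 < n) : 0 < fundConst n := by
  have h2 : (2 : ℝ) < n := by exact_mod_cast hn
  have hv : 0 < (volume (Metric.ball (0 : Eu n) 1)).toReal :=
    ENNReal.toReal_pos (Metric.measure_ball_pos volume _ one_pos).ne' measure_ball_lt_top.ne
  rw [fundConst, sphereArea]
  have : 0 < (n : ℝ) - 2 := by linarith
  positivity

theorem fundSol_sub (hn : 2 < n) (x a : Eu n) :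
    fundSol n (x - a) = -(fundConst n * newton a x) := by
  rw [fundSol, fundConst, newton, ← Real.rpow_natCast, ← Real.rpow_neg (norm_nonneg _),
    Nat.cast_sub hn.le]
  simp

theorem neg_greenFn (hn : 2 < n) (U : Eu n → Eu n → ℝ) (x z : Eu n) :
    -greenFn U x z = fundConst n * newton z x + U x z := by
  rw [greenFn, fundSol_sub hn]; ring

theorem IsGreenCorrection.eq_newton (hn : 2 < n) {D : Set (Eu n)} {U : Eu n → Eu n → ℝ}
    (hU : IsGreenCorrection D U) {z x : Eu n} (hz : z ∈ D) (hD : IsOpen D)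
    (hx : x ∈ closure D) (hxD : x ∉ D) : U x z = -(fundConst n * newton z x) := by
  rw [(hU z hz).2.2 x (by rw [hD.frontier_eq]; exact ⟨hx, hxD⟩), ← fundSol_sub hn, fundSol,
    fundSol, norm_sub_rev]

theorem greenFn_nonpos (hn : 2 < n) {D : Set (Eu n)} (hD : IsOpen D)
    (hb : Bornology.IsBounded D) {U : Eu n → Eu n → ℝ} (hU : IsGreenCorrection D U) {z x : Eu n}
    (hz : z ∈ D) (hx : x ∈ D) (hxz : x ≠ z) : greenFn U x z ≤ 0 := by
  obtain ⟨hUh, hUc, -⟩ := hU z hz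
  have hk := fundConst_pos hn
  obtain ⟨M, hM⟩ := (Metric.isCompact_of_isClosed_isBounded isClosed_closure
    hb.closure).exists_bound_of_continuousOn hUc
  have hM0 : 0 ≤ M := (norm_nonneg _).trans (hM z (subset_closure hz))
  have hxz' : 0 < ‖x - z‖ := norm_pos_iff.2 (sub_ne_zero.2 hxz)
  obtain ⟨ε, hε, hεx, hε1, hεM⟩ :
      ∃ ε > 0, ε < ‖x - z‖ ∧ ε ≤ 1 ∧ ε * (M + 1) ≤ fundConst n := by
    refine ⟨min (‖x - z‖ / 2) (min 1 (fundConst n / (M + 1))), by positivity,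
      (min_le_left _ _).trans_lt (by linarith),
      (min_le_right _ _).trans (min_le_left _ _), ?_⟩
    rw [← le_div_iff₀ (by positivity)]
    exact (min_le_right _ _).trans (min_le_right _ _)
  have hW : IsOpen (D ∩ {p | ε < ‖p - z‖}) :=
    hD.inter (isOpen_lt continuous_const (by fun_prop))
  have hcl : ∀ ξ ∈ closure (D ∩ {p | ε < ‖p - z‖}), ε ≤ ‖ξ - z‖ := fun ξ hξ =>
    closure_lt_subset_le continuous_const (by fun_prop)
      (closure_mono Set.inter_subset_right hξ)
  have hzW : z ∉ closure (D ∩ {p | ε < ‖p - z‖}) := fun h => by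
    have := hcl z h
    simp at this
    linarith
  have key := IsHarmonicOn.nonpos_of_boundary
    (u := fun ξ => -fundConst n * newton z ξ + (-1) * U ξ z) (by omega) hW
    (hb.subset Set.inter_subset_left)
    (((isHarmonicOn_newton hn fun h => hzW (subset_closure h)).const_mul _).add hW
      ((hUh.mono Set.inter_subset_left).const_mul _))
    ((continuousOn_const.mul (continuousOn_newton hzW)).add
      (continuousOn_const.mul (hUc.mono (closure_mono Set.inter_subset_left))))
    (fun ξ hξ hξW => by
      have hξD := closure_mono Set.inter_subset_left hξ
      by_cases h : ξ ∈ D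
      · have hε' : ‖ξ - z‖ = ε := le_antisymm (not_lt.1 fun h' => hξW ⟨h, h'⟩) (hcl ξ hξ)
        have h1 : M ≤ fundConst n * newton z ξ := by
          rw [newton, hε', ← div_eq_mul_inv, le_div_iff₀ (by positivity)]
          calc M * ε ^ (n - 2) ≤ (M + 1) * ε ^ 1 := by
                gcongr ?_ * ?_
                · linarith
                · exact pow_le_pow_of_le_one hε.le hε1 (by omega)
            _ ≤ fundConst n := by linarith
        have h2 := (abs_le.1 (hM ξ hξD)).1
        linarith
      · rw [hU.eq_newton hn hz hD hξD h]
        linarith) x ⟨hx, hεx⟩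
  have := neg_greenFn hn U x z
  linarith

theorem neg_greenFn_le_exterior_ball (hn : 2 < n) {D : Set (Eu n)} (hD : IsOpen D)
    (hb : Bornology.IsBounded D) {U : Eu n → Eu n → ℝ} (hU : IsGreenCorrection D U)
    {z x c : Eu n} {r : ℝ} (hr : 0 < r) (hball : Metric.ball c r ∩ D = ∅) (hz : z ∈ D)
    (hx : x ∈ D) :
    -greenFn U x z ≤ fundConst n *
      (newton z x - (r / ‖z - c‖) ^ (n - 2) * newton (sphereInv c r z) x) := by
  obtain ⟨hUh, hUc, -⟩ := hU z hz
  have hk := fundConst_pos hn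
  have hs := lt_norm_sub_of_mem hD hr hball hz
  have hs0 : 0 < ‖z - c‖ := hr.trans hs
  have hinv : sphereInv c r z ∉ closure D := fun h => by
    have := le_norm_sub_of_mem_closure hball h
    rw [norm_sphereInv_sub c hs0, le_div_iff₀ hs0, sq] at this
    exact absurd (le_of_mul_le_mul_left this hr) (not_le.2 hs)
  have key := IsHarmonicOn.nonpos_of_boundary
    (u := fun ξ => U ξ z +
      fundConst n * (r / ‖z - c‖) ^ (n - 2) * newton (sphereInv c r z) ξ) (by omega) hD hb
    (hUh.add hD ((isHarmonicOn_newton hn fun h => hinv (subset_closure h)).const_mul _))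
    (hUc.add (continuousOn_const.mul (continuousOn_newton hinv)))
    (fun ξ hξ hξD => by
      have hξz : 0 < ‖ξ - z‖ := norm_pos_iff.2 (sub_ne_zero.2 fun h => hξD (h ▸ hz))
      have hξi : 0 < ‖ξ - sphereInv c r z‖ :=
        norm_pos_iff.2 (sub_ne_zero.2 fun h => hinv (h ▸ hξ))
      rw [hU.eq_newton hn hz hD hξ hξD, mul_assoc]
      have h1 := mul_norm_sub_le_mul_norm_sub_sphereInv hr hs.le
        (le_norm_sub_of_mem_closure hball hξ)
      have h2 : (r / ‖z - c‖) ^ (n - 2) * newton (sphereInv c r z) ξ ≤ newton z ξ := by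
        rw [newton, newton, ← inv_pow, ← inv_pow, ← mul_pow]
        gcongr
        rw [← div_eq_mul_inv, div_div, inv_eq_one_div, div_le_div_iff₀ (by positivity) hξz]
        linarith
      have := mul_le_mul_of_nonneg_left h2 hk.le
      linarith) x hx
  rw [neg_greenFn hn]
  linarith

theorem neg_greenFn_le_of_pole_near (hn : 2 < n) {D : Set (Eu n)} (hD : IsOpen D)
    (hb : Bornology.IsBounded D) {U : Eu n → Eu n → ℝ} (hU : IsGreenCorrection D U)
    {z x y c : Eu n} {r t d : ℝ} (hr : 0 < r) (hball : Metric.ball c r ∩ D = ∅)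
    (hyc : dist y c = r) (hz : z ∈ D) (hx : x ∈ D) (hxz : x ≠ z) (hzy : dist z y ≤ t)
    (htr : t ≤ r) (hd : dist x z ≤ d) :
    -greenFn U x z ≤
      fundConst n * (d / r + 4) * (n - 2 : ℕ) * t * (‖x - z‖ ^ (n - 1))⁻¹ := by
  have hk := fundConst_pos hn
  have hs := lt_norm_sub_of_mem hD hr hball hz
  have hs0 : 0 < ‖z - c‖ := hr.trans hs
  have hst : ‖z - c‖ ≤ r + t := by
    have := dist_triangle z y c
    rw [← dist_eq_norm]; linarith
  have hb0 : 0 < ‖x - sphereInv c r z‖ := by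
    have h1 := mul_norm_sub_le_mul_norm_sub_sphereInv hr hs.le
      (lt_norm_sub_of_mem hD hr hball hx).le
    have h2 : 0 < r * ‖x - z‖ := mul_pos hr (norm_pos_iff.2 (sub_ne_zero.2 hxz))
    exact pos_of_mul_pos_right (h2.trans_le h1) hs0.le
  have h1 := inv_pow_sub_le (d := d) (norm_pos_iff.2 (sub_ne_zero.2 hxz)) hb0 hr hs0 hst
    (dist_nonneg.trans hzy) htr
    (by
      have := norm_sub_le_norm_sub_add_norm_sub x z (sphereInv c r z)
      have := norm_sub_sphereInv c hr hs.le
      linarith) (by rwa [← dist_eq_norm]) (n - 2)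
  rw [show n - 2 + 1 = n - 1 by omega] at h1
  calc -greenFn U x z ≤ fundConst n *
        (newton z x - (r / ‖z - c‖) ^ (n - 2) * newton (sphereInv c r z) x) :=
        neg_greenFn_le_exterior_ball hn hD hb hU hr hball hz hx
    _ ≤ fundConst n * ((d / r + 4) * (n - 2 : ℕ) * t * (‖x - z‖ ^ (n - 1))⁻¹) := by
        gcongr; exact h1
    _ = _ := by ring

theorem fderiv_normal_bounds {f : Eu n → ℝ} {y v : Eu n} {B ε : ℝ} (hB : 0 ≤ B) (hε : 0 < ε)
    (h : ∀ t, 0 < t → t < ε → f (y - t • v) ≤ 0 ∧ -f (y - t • v) ≤ B * t) :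
    0 ≤ fderiv ℝ f y v ∧ fderiv ℝ f y v ≤ B := by
  by_cases hf : DifferentiableAt ℝ f y
  swap
  · simp [fderiv_zero_of_not_differentiableAt hf, hB]
  have hl : HasDerivAt (fun t : ℝ => y - t • v) (-v) 0 := by
    simpa using ((hasDerivAt_id (0 : ℝ)).smul_const v).const_sub y
  have hd : HasDerivAt (fun t : ℝ => f (y - t • v)) (-fderiv ℝ f y v) 0 := by
    have h0 : HasFDerivAt f (fderiv ℝ f y) (y - (0 : ℝ) • v) := by simpa using hf.hasFDerivAt
    have := h0.comp_hasDerivAt 0 hl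
    rwa [map_neg] at this
  have hev : ∀ᶠ t : ℝ in nhdsWithin 0 (Set.Ioi 0), 0 < t ∧ t < ε :=
    Ioo_mem_nhdsGT hε
  have hlim : Filter.Tendsto (fun t : ℝ => f (y - t • v)) (nhdsWithin 0 (Set.Ioi 0))
      (nhds (f y)) := by
    simpa using hd.continuousAt.tendsto.mono_left nhdsWithin_le_nhds
  have hBt : Filter.Tendsto (fun t : ℝ => -(B * t)) (nhdsWithin 0 (Set.Ioi 0)) (nhds 0) := by
    have : Continuous fun t : ℝ => -(B * t) := by fun_prop
    simpa using this.continuousAt.tendsto.mono_left (nhdsWithin_le_nhds (a := (0 : ℝ)))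
  have hfy : f y = 0 := le_antisymm
    (le_of_tendsto hlim (hev.mono fun t ht => (h t ht.1 ht.2).1))
    (le_of_tendsto_of_tendsto hBt hlim (hev.mono fun t ht => by
      have := (h t ht.1 ht.2).2; linarith))
  have hsl := hd.tendsto_slope_zero_right
  simp only [zero_add, zero_smul, sub_zero, hfy, smul_eq_mul] at hsl
  constructor
  · have := le_of_tendsto hsl (hev.mono fun t ht =>
      mul_nonpos_of_nonneg_of_nonpos (inv_nonneg.2 ht.1.le) (h t ht.1 ht.2).1)
    linarith
  · have := ge_of_tendsto hsl (b := -B) (hev.mono fun t ht => by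
      rw [inv_mul_eq_div, le_div_iff₀ ht.1]
      have := (h t ht.1 ht.2).2; linarith)
    linarith

/-- The Grüter–Widman bound `|G(x,z)| ≤ C δ(x) t / |x - y| ^ n` for poles `z` at distance at
most `t` from the boundary point `y`. -/
theorem exists_neg_greenFn_le (hn : 2 < n) {D : Set (Eu n)} (hD : IsOpen D)
    (hb : Bornology.IsBounded D) {U : Eu n → Eu n → ℝ} (hU : IsGreenCorrection D U) {r : ℝ}
    (hr : 0 < r) (hsph : ∀ y ∈ frontier D, ∃ c, dist y c = r ∧ Metric.ball c r ∩ D = ∅) :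
    ∃ C > 0, ∀ x ∈ D, ∀ y ∈ frontier D, ∀ z ∈ D, ∀ t, dist z y ≤ t → t ≤ r →
      t ≤ dist x y / 16 → -greenFn U x z ≤ C * bdist D x / ‖x - y‖ ^ n * t := by
  have hk := fundConst_pos hn
  have hm : (1 : ℝ) ≤ (n - 2 : ℕ) := by exact_mod_cast (by omega : 1 ≤ n - 2)
  set d := Metric.diam (closure D) + r
  have hd0 : 0 < d := add_pos_of_nonneg_of_pos Metric.diam_nonneg hr
  have hd {p q : Eu n} (hp : p ∈ closure D) (hq : q ∈ closure D) : dist p q ≤ d :=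
    (Metric.dist_le_diam_of_mem hb.closure hp hq).trans (by simp only [d]; linarith)
  set C₁ := fundConst n * (d / r + 4) * (n - 2 : ℕ) * 8 ^ (n - 1)
  have hC₁ : 0 < C₁ := by positivity
  set κ := min (1 / 6) (r / d)
  have hκ : 0 < κ := by positivity
  have hκ6 : κ ≤ 1 / 6 := min_le_left _ _
  refine ⟨C₁ * (2 * (n - 2 : ℕ) / κ), by positivity, fun x hx y hy z hz t hzy htr htR => ?_⟩
  have hxy : x ≠ y := fun h => by
    rw [hD.frontier_eq] at hy; exact hy.2 (h ▸ hx)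
  set R := dist x y with hRdef
  have hR : 0 < R := dist_pos.2 hxy
  have ht : 0 ≤ t := dist_nonneg.trans hzy
  rw [← dist_eq_norm x y, ← hRdef]
  obtain ⟨c, hyc, hball⟩ := hsph y hy
  have hfar {ξ : Eu n} (hξ : ξ ∈ D) (hξR : R / 4 ≤ dist ξ y) :
      -greenFn U ξ z ≤ C₁ * t / R ^ (n - 1) := by
    have h8 : R / 8 ≤ ‖ξ - z‖ := by
      have := dist_triangle ξ z y
      rw [← dist_eq_norm]; linarith
    have hξz : ξ ≠ z := fun h => by
      rw [h, sub_self, norm_zero] at h8; linarith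
    calc -greenFn U ξ z
        ≤ fundConst n * (d / r + 4) * (n - 2 : ℕ) * t * (‖ξ - z‖ ^ (n - 1))⁻¹ :=
          neg_greenFn_le_of_pole_near hn hD hb hU hr hball hyc hz hξ hξz hzy htr
            (hd (subset_closure hξ) (subset_closure hz))
      _ ≤ fundConst n * (d / r + 4) * (n - 2 : ℕ) * t * ((R / 8) ^ (n - 1))⁻¹ := by gcongr
      _ = C₁ * t / R ^ (n - 1) := by
          rw [div_pow]; simp only [C₁]; field_simp
  have hRn : R ^ n = R ^ (n - 1) * R := by rw [← pow_succ]; congr 1; omega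
  have hne : D ≠ Set.univ := fun h => by simp [h] at hy
  obtain ⟨x₀, hx₀, hδ⟩ := exists_mem_frontier_infDist_compl_eq_dist hx hne
  rw [bdist, hδ]
  have hgoal : C₁ * (2 * (n - 2 : ℕ) / κ) * dist x x₀ / R ^ n * t
      = 2 * (C₁ * t / R ^ (n - 1)) * (n - 2 : ℕ) * (dist x x₀ / (κ * R)) := by
    rw [hRn]; field_simp
  rw [hgoal]
  rcases le_or_gt (R / 4) (dist x x₀) with hfx | hnear
  · have h1 : 1 ≤ 2 * (n - 2 : ℕ) * (dist x x₀ / (κ * R)) := by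
      have : 3 / 2 ≤ dist x x₀ / (κ * R) := by
        rw [le_div_iff₀ (by positivity)]
        have : κ * R ≤ 1 / 6 * R := by gcongr
        linarith
      nlinarith
    calc -greenFn U x z ≤ C₁ * t / R ^ (n - 1) * 1 := by
          rw [mul_one]; exact hfar hx (by linarith)
      _ ≤ C₁ * t / R ^ (n - 1) * (2 * (n - 2 : ℕ) * (dist x x₀ / (κ * R))) := by gcongr
      _ = _ := by ring
  · have hκr : κ * R ≤ r := by
      have h1 : R ≤ d := hd (subset_closure hx) (frontier_subset_closure hy)
      calc κ * R ≤ r / d * d := by gcongr; exact min_le_right _ _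
        _ = r := by field_simp
    obtain ⟨c₀, hx₀c, hball₀⟩ := hsph x₀ hx₀
    obtain ⟨c', hc', hball'⟩ := exists_smaller_exterior_ball hr hx₀c hball₀
      (by positivity : 0 ≤ κ * R) hκr
    have hyfar {ξ : Eu n} (hξ : dist ξ x₀ ≤ R / 2) : R / 4 ≤ dist ξ y := by
      have h1 := dist_triangle x ξ y
      have h2 := dist_triangle_right x ξ x₀
      linarith
    have hzW : z ∉ closure (D ∩ Metric.ball x₀ (R / 2)) := fun h => by
      have := hyfar (Metric.closure_ball_subset_closedBall
        (closure_mono Set.inter_subset_right h))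
      linarith
    obtain ⟨hUh, hUc, -⟩ := hU z hz
    rw [neg_greenFn hn]
    refine IsHarmonicOn.le_of_exterior_ball
      (u := fun ξ => fundConst n * newton z ξ + U ξ z) (c := c') (R := R / 2)
      hn hD (by positivity) ?_ (by positivity) hc' hball' ?_ ?_ ?_ ?_ hx (by linarith)
    · have : κ * R ≤ 1 / 6 * R := by gcongr
      linarith
    · exact ((isHarmonicOn_newton hn fun h => hzW (subset_closure h)).const_mul _).add
        (hD.inter Metric.isOpen_ball) (hUh.mono Set.inter_subset_left)
    · exact (continuousOn_const.mul (continuousOn_newton hzW)).add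
        (hUc.mono (closure_mono Set.inter_subset_left))
    · intro ξ hξ hξD _
      rw [hU.eq_newton hn hz hD hξ hξD]
      linarith
    · intro ξ hξ hξR
      rw [← neg_greenFn hn]
      exact hfar hξ (hyfar hξR.le)

/-- Grüter–Widman, Proposition 2.1: for a bounded domain satisfying the
uniform exterior sphere condition, the Poisson kernel P(x,y) = ∂G(x,y)/∂ν(y) satisfies
0 ≤ P(x,y) ≤ C δ(x)/|x−y|ⁿ for x ∈ D, y ∈ ∂D. -/
theorem stmt3 {n : ℕ} (hn : 2 < n) (D : Set (Eu n)) (hD : IsBddDomain D)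
    (hsph : UnifExtSphere D) (U : Eu n → Eu n → ℝ) (hU : IsGreenCorrection D U) :
    ∃ C : ℝ, 0 < C ∧ ∀ x ∈ D, ∀ y ∈ frontier D, ∀ v : Eu n, IsOutwardNormalAt D y v →
      0 ≤ fderiv ℝ (fun z => greenFn U x z) y v ∧
      fderiv ℝ (fun z => greenFn U x z) y v ≤ C * bdist D x / ‖x - y‖ ^ n := by
  obtain ⟨r, hr, hsph⟩ := hsph
  obtain ⟨hDo, -, hb⟩ := hD
  obtain ⟨C, hC, hbound⟩ := exists_neg_greenFn_le hn hDo hb hU hr hsph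
  refine ⟨C, hC, fun x hx y hy v hv => ?_⟩
  obtain ⟨hv1, ε, hε, -, hin⟩ := hv
  have hxy : x ≠ y := fun h => by
    rw [hDo.frontier_eq] at hy; exact hy.2 (h ▸ hx)
  have hR : 0 < dist x y := dist_pos.2 hxy
  have hδ : 0 ≤ bdist D x := Metric.infDist_nonneg
  refine fderiv_normal_bounds (ε := min ε (min r (dist x y / 16))) (by positivity)
    (by positivity) fun t ht htε => ?_
  obtain ⟨h1, h2, h3⟩ : t < ε ∧ t < r ∧ t < dist x y / 16 := by
    simpa only [lt_min_iff] using htε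
  have hz := hin t ht h1
  have hzy : dist (y - t • v) y = t := by
    rw [dist_eq_norm, sub_sub_cancel_left, norm_neg, norm_smul, hv1, mul_one,
      Real.norm_of_nonneg ht.le]
  refine ⟨greenFn_nonpos hn hDo hb hU hz hx fun h => ?_,
    hbound x hx y hy _ hz t hzy.le h2.le h3.le⟩
  rw [← h] at hzy
  linarith
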